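/- Let V be a cocontinuous quantale. For every ε ∈ V with ε ≫ 0 and every natural number n ≥ 1, there exists δ ∈ V with δ ≫ 0 such that ε ≫ n·δ, where n·δ denotes the n-fold sum δ + δ + ⋯ + δ. -/

import Mathlib

/-- `WayAbove y x` means `y ≫ x`: for every nonempty downward-directed set `S`
with `sInf S ≤ x` there exists `s ∈ S` with `s ≤ y`. -/
def WayAbove {L : Type*} [CompleteLattice L] (y x : L) : Prop :=
  ∀ S : Set L, S.Nonempty → DirectedOn (· ≥ ·) S → sInf S ≤ x → ∃ s ∈ S, s ≤ y

/-- A complete lattice is cocontinuous if for every `x` the set `{y | y ≫ x}` is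
nonempty, downward-directed, and has infimum `x`. -/
def Cocontinuous (L : Type*) [CompleteLattice L] : Prop :=
  ∀ x : L, {y | WayAbove y x}.Nonempty ∧ DirectedOn (· ≥ ·) {y | WayAbove y x} ∧
    x = sInf {y | WayAbove y x}

theorem WayAbove.mono {L : Type*} [CompleteLattice L] {y z x w : L}
    (h : WayAbove y x) (hyz : y ≤ z) (hwx : w ≤ x) : WayAbove z w := by
  intro S hne hdir hS
  obtain ⟨s, hs, hsy⟩ := h S hne hdir (hS.trans hwx)
  exact ⟨s, hs, hsy.trans hyz⟩

theorem Cocontinuous.exists_between {L : Type*} [CompleteLattice L] (hL : Cocontinuous L)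
    {z x : L} (h : WayAbove z x) : ∃ y, WayAbove z y ∧ WayAbove y x := by
  obtain ⟨⟨y₀, hy₀⟩, hdir, hinf⟩ := hL x
  obtain ⟨z₀, hz₀⟩ := (hL y₀).1
  have hSne : {w | ∃ y, WayAbove y x ∧ WayAbove w y}.Nonempty := ⟨z₀, y₀, hy₀, hz₀⟩
  have hSdir : DirectedOn (· ≥ ·) {w | ∃ y, WayAbove y x ∧ WayAbove w y} := by
    rintro w₁ ⟨y₁, hy₁, hw₁⟩ w₂ ⟨y₂, hy₂, hw₂⟩
    obtain ⟨y, hy, hyy₁, hyy₂⟩ := hdir y₁ hy₁ y₂ hy₂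
    obtain ⟨w, hw, hww₁, hww₂⟩ :=
      (hL y).2.1 w₁ (hw₁.mono le_rfl hyy₁) w₂ (hw₂.mono le_rfl hyy₂)
    exact ⟨w, ⟨y, hy, hw⟩, hww₁, hww₂⟩
  have hSinf : sInf {w | ∃ y, WayAbove y x ∧ WayAbove w y} ≤ x := by
    conv_rhs => rw [hinf]
    refine le_sInf fun y hy => ?_
    conv_rhs => rw [(hL y).2.2]
    exact le_sInf fun w hw => sInf_le ⟨y, hy, hw⟩
  obtain ⟨w, ⟨y, hyx, hwy⟩, hwz⟩ := h _ hSne hSdir hSinf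
  exact ⟨y, hwy.mono hwz le_rfl, hyx⟩

theorem add_le_add_left_of_add_sInf {V : Type*} [CompleteLattice V] [AddCommMonoid V]
    (hdist : ∀ (a : V) (s : Set V), a + sInf s = ⨅ b ∈ s, a + b)
    (a : V) {b c : V} (h : b ≤ c) : a + b ≤ a + c := by
  have hbc := hdist a {b, c}
  rw [sInf_pair, inf_eq_left.mpr h] at hbc
  rw [hbc]
  exact iInf₂_le c (by simp)

theorem add_le_add_of_add_sInf {V : Type*} [CompleteLattice V] [AddCommMonoid V]
    (hdist : ∀ (a : V) (s : Set V), a + sInf s = ⨅ b ∈ s, a + b)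
    {a b c d : V} (hab : a ≤ b) (hcd : c ≤ d) : a + c ≤ b + d := by
  refine (add_le_add_left_of_add_sInf hdist a hcd).trans ?_
  rw [add_comm a d, add_comm b d]
  exact add_le_add_left_of_add_sInf hdist d hab

theorem exists_wayAbove_zero_add_self_le {V : Type*} [CompleteLattice V] [AddCommMonoid V]
    (hdist : ∀ (a : V) (s : Set V), a + sInf s = ⨅ b ∈ s, a + b)
    (hcocont : Cocontinuous V) {ε : V} (hε : WayAbove ε 0) :
    ∃ δ : V, WayAbove δ 0 ∧ δ + δ ≤ ε := by
  obtain ⟨hne, hdir, hinf⟩ := hcocont 0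
  have hSdir : DirectedOn (· ≥ ·) ((fun δ => δ + δ) '' {y : V | WayAbove y 0}) := by
    rintro _ ⟨a, ha, rfl⟩ _ ⟨b, hb, rfl⟩
    obtain ⟨c, hc, hca, hcb⟩ := hdir a ha b hb
    exact ⟨c + c, ⟨c, hc, rfl⟩, add_le_add_of_add_sInf hdist hca hca,
      add_le_add_of_add_sInf hdist hcb hcb⟩
  have hSinf : sInf ((fun δ => δ + δ) '' {y : V | WayAbove y 0}) ≤ 0 := by
    conv_rhs => rw [hinf]
    refine le_sInf fun a ha => ?_
    conv_rhs => rw [← add_zero a, hinf, hdist]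
    refine le_iInf₂ fun b hb => ?_
    obtain ⟨c, hc, hca, hcb⟩ := hdir a ha b hb
    exact (sInf_le (Set.mem_image_of_mem _ hc)).trans (add_le_add_of_add_sInf hdist hca hcb)
  obtain ⟨_, ⟨δ, hδ, rfl⟩, hle⟩ := hε _ (hne.image _) hSdir hSinf
  exact ⟨δ, hδ, hle⟩

theorem exists_wayAbove_zero_nsmul_le {V : Type*} [CompleteLattice V] [AddCommMonoid V]
    (hbot : (⊥ : V) = 0)
    (hdist : ∀ (a : V) (s : Set V), a + sInf s = ⨅ b ∈ s, a + b)
    (hcocont : Cocontinuous V) (n : ℕ) {ε : V} (hε : WayAbove ε 0) :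
    ∃ δ : V, WayAbove δ 0 ∧ n • δ ≤ ε := by
  induction n generalizing ε with
  | zero => exact ⟨ε, hε, by rw [zero_nsmul, ← hbot]; exact bot_le⟩
  | succ n ih =>
    obtain ⟨η, hη, hηε⟩ := exists_wayAbove_zero_add_self_le hdist hcocont hε
    obtain ⟨ξ, hξ, hξη⟩ := ih hη
    obtain ⟨δ, hδ, hδξ, hδη⟩ := (hcocont 0).2.1 ξ hξ η hη
    have hmono : ∀ k : ℕ, k • δ ≤ k • ξ := by
      intro k
      induction k with
      | zero => simp
      | succ k ihk =>
        rw [succ_nsmul, succ_nsmul]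
        exact add_le_add_of_add_sInf hdist ihk hδξ
    refine ⟨δ, hδ, ?_⟩
    rw [succ_nsmul]
    exact (add_le_add_of_add_sInf hdist ((hmono n).trans hξη) hδη).trans hηε

theorem exists_nth {V : Type*} [CompleteLattice V] [AddCommMonoid V]
    (hbot : (⊥ : V) = 0)
    (hdist : ∀ (a : V) (s : Set V), a + sInf s = ⨅ b ∈ s, a + b)
    (hcocont : Cocontinuous V) (ε : V) (hε : WayAbove ε 0) (n : ℕ) (hn : 1 ≤ n) :
    ∃ δ : V, WayAbove δ 0 ∧ WayAbove ε (n • δ) := by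
  obtain ⟨η, hεη, hη⟩ := hcocont.exists_between hε
  obtain ⟨δ, hδ, hle⟩ := exists_wayAbove_zero_nsmul_le hbot hdist hcocont n hη
  exact ⟨δ, hδ, hεη.mono le_rfl hle⟩
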